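/- Let K be an algebraically closed field, complete with respect to a nontrivial non-Archimedean absolute value |·|. Let b ∈ K, let r > 0 be a real number, let n ≥ 1 be a natural number, and let f(z) = ∑_{k≥0} c_k (z − b)^k be a nonzero power series with |c_k| r^k → 0 and with c_0 = c_1 = ⋯ = c_n = 0 (so f has a zero of multiplicity greater than n at b). Then there exists ε > 0 such that every power series g(z) = ∑_{k≥0} d_k (z − b)^k with |d_k| r^k → 0, with d_0 = 0, with d_j ≠ 0 for some 1 ≤ j ≤ n, and with |c_k − d_k| < ε for all k ≤ K(f,r), has a zero in the closed ball B̄ = {z : |z − b| ≤ r} distinct from b. -/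

import Mathlib

open Filter

section

open Polynomial

/-- If every `y ∈ s` has norm larger than `ρ`, the constant coefficient of `∏ (X - y)` strictly
dominates on the disc of radius `ρ`. -/
lemma prod_X_sub_C_coeff_norm_lt {K : Type*} [NormedField K] [IsUltrametricDist K]
    {ρ : ℝ} (hρ : 0 ≤ ρ) (s : Multiset K) (hs : ∀ y ∈ s, ρ < ‖y‖) :
    (s.map (fun y => X - C y)).prod.coeff 0 ≠ 0 ∧ ∀ k, 1 ≤ k →
      ‖(s.map (fun y => X - C y)).prod.coeff k‖ * ρ ^ k <
        ‖(s.map (fun y => X - C y)).prod.coeff 0‖ := by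
  induction s using Multiset.induction_on with
  | empty =>
    refine ⟨by simp, fun k hk => ?_⟩
    have hk0 : k ≠ 0 := by omega
    simp [coeff_one, hk0]
  | cons y s ih =>
    obtain ⟨h0, hk⟩ := ih fun z hz => hs z (Multiset.mem_cons_of_mem hz)
    have hy : ρ < ‖y‖ := hs y (Multiset.mem_cons_self y s)
    rw [Multiset.map_cons, Multiset.prod_cons]
    set q := (s.map (fun y => X - C y)).prod
    have hq0 : 0 < ‖q.coeff 0‖ := norm_pos_iff.mpr h0
    have hcoeff : ((X - C y) * q).coeff 0 = -(y * q.coeff 0) := by simp [mul_coeff_zero]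
    have hy0 : 0 < ‖y‖ := hρ.trans_lt hy
    refine ⟨?_, fun k hk1 => ?_⟩
    · rw [hcoeff]
      exact neg_ne_zero.mpr (mul_ne_zero (norm_pos_iff.mp hy0) h0)
    obtain ⟨k, rfl⟩ := Nat.exists_eq_add_of_le' hk1
    have hle : ‖q.coeff k‖ * ρ ^ k ≤ ‖q.coeff 0‖ := by
      rcases Nat.eq_zero_or_pos k with rfl | hk'
      · simp
      · exact (hk k hk').le
    have hstep : ((X - C y) * q).coeff (k + 1) = q.coeff k - y * q.coeff (k + 1) := by
      rw [sub_mul, coeff_sub, coeff_X_mul, coeff_C_mul]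
    rw [hcoeff, hstep, norm_neg, norm_mul]
    have hρk : 0 ≤ ρ ^ (k + 1) := pow_nonneg hρ _
    rw [sub_eq_add_neg]
    refine (mul_le_mul_of_nonneg_right (IsUltrametricDist.norm_add_le_max _ _) hρk).trans_lt ?_
    rw [max_mul_of_nonneg _ _ hρk, max_lt_iff]
    constructor
    · calc ‖q.coeff k‖ * ρ ^ (k + 1) = ρ * (‖q.coeff k‖ * ρ ^ k) := by ring
        _ ≤ ρ * ‖q.coeff 0‖ := mul_le_mul_of_nonneg_left hle hρ
        _ < ‖y‖ * ‖q.coeff 0‖ := mul_lt_mul_of_pos_right hy hq0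
    · rw [norm_neg, norm_mul, mul_assoc]
      exact mul_lt_mul_of_pos_left (hk _ (by omega)) hy0

/-- A polynomial with `p.coeff k ≠ 0` for some `k ≥ 1` has a root `y` with
`‖p.coeff k‖ * ‖y‖ ^ k ≤ ‖p.coeff 0‖`. -/
lemma exists_isRoot_norm_coeff_mul_pow_le {K : Type*} [NormedField K] [IsUltrametricDist K]
    [IsAlgClosed K] (p : K[X]) {k : ℕ} (hk : 1 ≤ k) (hpk : p.coeff k ≠ 0) :
    ∃ y, p.IsRoot y ∧ ‖p.coeff k‖ * ‖y‖ ^ k ≤ ‖p.coeff 0‖ := by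
  have hk0 : k ≠ 0 := by omega
  have hp : p ≠ 0 := by
    rintro rfl
    simp at hpk
  have hpos : 0 < ‖p.coeff k‖ := norm_pos_iff.mpr hpk
  set ρ : ℝ := (‖p.coeff 0‖ / ‖p.coeff k‖) ^ (k : ℝ)⁻¹
  have hρ : 0 ≤ ρ := by positivity
  have hρk : ‖p.coeff k‖ * ρ ^ k = ‖p.coeff 0‖ := by
    rw [Real.rpow_inv_natCast_pow (by positivity) hk0, mul_div_cancel₀ _ hpos.ne']
  by_contra! hcon
  have hroots : ∀ y ∈ p.roots, ρ < ‖y‖ := fun y hy => by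
    have h := hcon y (isRoot_of_mem_roots hy)
    rw [← hρk] at h
    exact lt_of_pow_lt_pow_left₀ k (norm_nonneg y) (lt_of_mul_lt_mul_left h hpos.le)
  have hlt := (prod_X_sub_C_coeff_norm_lt hρ p.roots hroots).2 k hk
  have hprod := (IsAlgClosed.splits p).eq_prod_roots
  have hlead : 0 < ‖p.leadingCoeff‖ := norm_pos_iff.mpr (leadingCoeff_ne_zero.mpr hp)
  have h := mul_lt_mul_of_pos_left hlt hlead
  rw [← mul_assoc, ← norm_mul, ← norm_mul, ← coeff_C_mul, ← coeff_C_mul, ← hprod, hρk] at h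
  exact h.false

/-- On the ball of radius `r`, the map `x ↦ x ^ k` is Lipschitz with constant `r ^ k / r`. -/
lemma norm_pow_sub_pow_mul_le {K : Type*} [NormedField K] [IsUltrametricDist K]
    {r : ℝ} (hr : 0 ≤ r) {x y : K} (hx : ‖x‖ ≤ r) (hy : ‖y‖ ≤ r) (k : ℕ) :
    ‖x ^ k - y ^ k‖ * r ≤ ‖x - y‖ * r ^ k := by
  induction k with
  | zero => simp
  | succ k ih =>
    have h : x ^ (k + 1) - y ^ (k + 1) = x * (x ^ k - y ^ k) + (x - y) * y ^ k := by ring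
    rw [h]
    refine (mul_le_mul_of_nonneg_right (IsUltrametricDist.norm_add_le_max _ _) hr).trans ?_
    rw [max_mul_of_nonneg _ _ hr, max_le_iff, norm_mul, norm_mul, norm_pow]
    constructor
    · calc ‖x‖ * ‖x ^ k - y ^ k‖ * r = ‖x‖ * (‖x ^ k - y ^ k‖ * r) := by ring
        _ ≤ r * (‖x - y‖ * r ^ k) := by gcongr
        _ = ‖x - y‖ * r ^ (k + 1) := by ring
    · calc ‖x - y‖ * ‖y‖ ^ k * r ≤ ‖x - y‖ * r ^ k * r := by gcongr
        _ = ‖x - y‖ * r ^ (k + 1) := by ring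

/-- If `M` is the last index maximizing `‖h k‖ * r ^ k`, recentring a truncation of the power
series inside the ball of radius `r` preserves the norm of the coefficient of index `M`. -/
lemma norm_taylor_coeff_truncation {K : Type*} [NormedField K] [IsUltrametricDist K]
    {r : ℝ} (hr : 0 < r) {h : ℕ → K} {M : ℕ}
    (hlast : ∀ m, M < m → ‖h m‖ * r ^ m < ‖h M‖ * r ^ M) {α : K} (hα : ‖α‖ ≤ r)
    {m : ℕ} (hm : M ≤ m) :
    ‖(taylor α (∑ k ∈ Finset.range (m + 1), monomial k (h k))).coeff M‖ = ‖h M‖ := by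
  rw [taylor_coeff, map_sum, eval_finsetSum]
  simp only [hasseDeriv_monomial, eval_monomial]
  rw [← Finset.add_sum_erase _ _ (Finset.mem_range.mpr (Nat.lt_succ_of_le hm))]
  simp only [Nat.choose_self, Nat.cast_one, one_mul, Nat.sub_self, pow_zero, mul_one]
  by_cases hM : h M = 0
  · have h1 := hlast (M + 1) (Nat.lt_succ_self M)
    rw [hM, norm_zero, zero_mul] at h1
    exact absurd h1 (not_lt.mpr (by positivity))
  have hlt : ‖∑ k ∈ (Finset.range (m + 1)).erase M,
      (k.choose M : K) * h k * α ^ (k - M)‖ < ‖h M‖ := by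
    obtain ⟨i, hi, hle⟩ := IsUltrametricDist.exists_norm_finsetSum_le
      ((Finset.range (m + 1)).erase M) (fun k => (k.choose M : K) * h k * α ^ (k - M))
    rcases ((Finset.range (m + 1)).erase M).eq_empty_or_nonempty with he | hne
    · simpa [he] using hM
    refine hle.trans_lt ?_
    have hiM : i ≠ M := (Finset.mem_erase.mp (hi hne)).1
    rcases lt_or_gt_of_ne hiM with hlt | hgt
    · simpa [Nat.choose_eq_zero_of_lt hlt] using hM
    have hpow : 0 < r ^ M := pow_pos hr M
    refine lt_of_mul_lt_mul_right ?_ hpow.le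
    refine lt_of_le_of_lt ?_ (hlast i hgt)
    rw [norm_mul, norm_mul, norm_pow]
    calc ‖(i.choose M : K)‖ * ‖h i‖ * ‖α‖ ^ (i - M) * r ^ M
        ≤ 1 * ‖h i‖ * r ^ (i - M) * r ^ M := by
          gcongr
          exact IsUltrametricDist.norm_natCast_le_one K _
      _ = ‖h i‖ * r ^ i := by
          rw [one_mul, mul_assoc, ← pow_add, Nat.sub_add_cancel hgt.le]
  rw [IsUltrametricDist.norm_add_eq_max_of_norm_ne_norm hlt.ne', max_eq_left hlt.le]

/-- Every point `α` of the ball has a root of the truncated power series nearby, at a distance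
controlled by the value of the truncation at `α`. -/
lemma exists_truncation_root_near {K : Type*} [NormedField K] [IsUltrametricDist K]
    [IsAlgClosed K] {r : ℝ} (hr : 0 < r) {h : ℕ → K} {M : ℕ} (hM : 1 ≤ M)
    (hmax : ∀ m, ‖h m‖ * r ^ m ≤ ‖h M‖ * r ^ M)
    (hlast : ∀ m, M < m → ‖h m‖ * r ^ m < ‖h M‖ * r ^ M) {α : K} (hα : ‖α‖ ≤ r)
    {m : ℕ} (hm : M ≤ m) :
    ∃ β : K, ‖β‖ ≤ r ∧ ∑ k ∈ Finset.range (m + 1), h k * β ^ k = 0 ∧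
      ‖h M‖ * ‖β - α‖ ^ M ≤ ‖∑ k ∈ Finset.range (m + 1), h k * α ^ k‖ := by
  set p : K[X] := ∑ k ∈ Finset.range (m + 1), monomial k (h k) with hp
  have heval : ∀ x, p.eval x = ∑ k ∈ Finset.range (m + 1), h k * x ^ k := fun x => by
    simp [hp, eval_finsetSum]
  have hcoeff : ‖(taylor α p).coeff M‖ = ‖h M‖ := norm_taylor_coeff_truncation hr hlast hα hm
  have hMpos : 0 < ‖h M‖ := by
    refine pos_of_mul_pos_left ((?_ : (0 : ℝ) ≤ _).trans_lt (hlast (M + 1) M.lt_succ_self))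
      (pow_pos hr M).le
    positivity
  obtain ⟨y, hy, hle⟩ := exists_isRoot_norm_coeff_mul_pow_le (taylor α p) hM
    (norm_pos_iff.mp (hcoeff ▸ hMpos))
  rw [hcoeff, taylor_coeff_zero, heval] at hle
  have hbound : ‖∑ k ∈ Finset.range (m + 1), h k * α ^ k‖ ≤ ‖h M‖ * r ^ M := by
    refine IsUltrametricDist.norm_sum_le_of_forall_le_of_nonneg (by positivity) fun k _ => ?_
    rw [norm_mul, norm_pow]
    exact le_trans (by gcongr) (hmax k)
  have hyr : ‖y‖ ≤ r :=
    le_of_pow_le_pow_left₀ (by omega) hr.le (le_of_mul_le_mul_left (hle.trans hbound) hMpos)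
  refine ⟨y + α,
    (IsUltrametricDist.norm_add_le_max y α).trans (max_le hyr hα), ?_, by simpa using hle⟩
  rw [← heval, ← taylor_eval]
  exact hy

/-- A real sequence tending to `0` with a positive term has a last maximizing index. -/
lemma exists_last_max_of_tendsto_zero {a : ℕ → ℝ} (ha : Tendsto a atTop (nhds 0)) {i : ℕ}
    (hi : 0 < a i) : ∃ M, (∀ m, a m ≤ a M) ∧ ∀ m, M < m → a m < a M := by
  classical
  obtain ⟨B, hB⟩ := eventually_atTop.mp (ha.eventually_lt_const hi)
  have hiB : i < B := by
    by_contra! hle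
    exact (hB i hle).false
  obtain ⟨M₀, hM₀, hmax⟩ := Finset.exists_max_image (Finset.range B) a
    ⟨i, Finset.mem_range.mpr hiB⟩
  have hmax₀ : ∀ m, a m ≤ a M₀ := fun m => by
    rcases lt_or_ge m B with hm | hm
    · exact hmax m (Finset.mem_range.mpr hm)
    · exact (hB m hm).le.trans (hmax i (Finset.mem_range.mpr hiB))
  have hspec : ∀ m, a m ≤ a (Nat.findGreatest (fun k => ∀ m, a m ≤ a k) B) :=
    Nat.findGreatest_spec (P := fun k => ∀ m, a m ≤ a k) (Finset.mem_range.mp hM₀).le hmax₀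
  refine ⟨_, hspec, fun m hm => ?_⟩
  by_contra! hle
  rcases lt_or_ge m B with hmB | hmB
  · exact Nat.findGreatest_is_greatest hm hmB.le fun l => (hspec l).trans hle
  · exact ((hB m hmB).trans_le ((hspec i).trans hle)).false

/-- A power series on the closed ball of radius `r` whose constant coefficient is not strictly
dominant has a zero in that ball. -/
theorem exists_hasSum_zero_of_norm_coeff_zero_le {K : Type*} [NormedField K]
    [IsUltrametricDist K] [IsAlgClosed K] [CompleteSpace K] {r : ℝ} (hr : 0 < r) {h : ℕ → K}
    (hlim : Tendsto (fun k => ‖h k‖ * r ^ k) atTop (nhds 0)) (h0 : h 0 ≠ 0) {N : ℕ}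
    (hN : 1 ≤ N) (hle : ‖h 0‖ ≤ ‖h N‖ * r ^ N) :
    ∃ z : K, ‖z‖ ≤ r ∧ HasSum (fun k => h k * z ^ k) 0 := by
  obtain ⟨M, hmax, hlast⟩ := exists_last_max_of_tendsto_zero hlim (i := 0) (by simpa using h0)
  have hM : 1 ≤ M := by
    by_contra! hM0
    obtain rfl : M = 0 := by omega
    exact (hlast N hN).not_ge (by simpa using hle)
  have hM0 : M ≠ 0 := by omega
  have hMpos : 0 < ‖h M‖ := by
    refine pos_of_mul_pos_left ((?_ : (0 : ℝ) ≤ _).trans_lt (hlast (M + 1) M.lt_succ_self))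
      (pow_pos hr M).le
    positivity
  have hnext : ∀ (m : ℕ) (α : Metric.closedBall (0 : K) r), ∃ β : Metric.closedBall (0 : K) r,
      ∑ k ∈ Finset.range (M + m + 1), h k * (β : K) ^ k = 0 ∧
      ‖h M‖ * ‖(β : K) - α‖ ^ M ≤ ‖∑ k ∈ Finset.range (M + m + 1), h k * (α : K) ^ k‖ := by
    intro m α
    obtain ⟨β, hβ, hroot, hdist⟩ := exists_truncation_root_near hr hM hmax hlast
      (mem_closedBall_zero_iff.mp α.2) (Nat.le_add_right M m)
    exact ⟨⟨β, mem_closedBall_zero_iff.mpr hβ⟩, hroot, hdist⟩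
  choose next hroot hdist using hnext
  obtain ⟨u, hu0, husucc⟩ : ∃ u : ℕ → Metric.closedBall (0 : K) r,
      u 0 = next 0 ⟨0, by simp [hr.le]⟩ ∧ ∀ m, u (m + 1) = next (m + 1) (u m) :=
    ⟨fun m => Nat.rec (next 0 ⟨0, by simp [hr.le]⟩) (fun m α => next (m + 1) α) m,
      rfl, fun _ => rfl⟩
  have hu : ∀ m, ‖(u m : K)‖ ≤ r := fun m => mem_closedBall_zero_iff.mp (u m).2
  have huroot : ∀ m, ∑ k ∈ Finset.range (M + m + 1), h k * (u m : K) ^ k = 0 := fun m => by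
    cases m with
    | zero => exact hu0 ▸ hroot 0 _
    | succ m => exact husucc m ▸ hroot (m + 1) _
  have hstep : ∀ m, ‖(u (m + 1) : K) - u m‖ ^ M ≤
      ‖h (M + m + 1)‖ * r ^ (M + m + 1) / ‖h M‖ := fun m => by
    have hd : ‖h M‖ * ‖(u (m + 1) : K) - u m‖ ^ M ≤
        ‖∑ k ∈ Finset.range (M + (m + 1) + 1), h k * (u m : K) ^ k‖ :=
      husucc m ▸ hdist (m + 1) (u m)
    rw [← add_assoc, Finset.sum_range_succ, huroot, zero_add, norm_mul, norm_pow] at hd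
    rw [le_div_iff₀' hMpos]
    refine hd.trans ?_
    gcongr
    exact hu m
  have hpow : Tendsto (fun m => ‖(u (m + 1) : K) - u m‖ ^ M) atTop (nhds 0) := by
    refine squeeze_zero (fun m => by positivity) hstep ?_
    have := (hlim.comp (tendsto_add_atTop_nat (M + 1))).div_const ‖h M‖
    rw [zero_div] at this
    refine this.congr fun m => ?_
    simp only [Function.comp_apply]
    rw [show m + (M + 1) = M + m + 1 by ring]
  have hdiff : Tendsto (fun m => (u (m + 1) : K) - u m) atTop (nhds 0) := by
    rw [tendsto_zero_iff_norm_tendsto_zero]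
    have := hpow.rpow_const (p := (M : ℝ)⁻¹) (Or.inr (by positivity))
    rw [Real.zero_rpow (by positivity)] at this
    exact this.congr fun m => Real.pow_rpow_inv_natCast (norm_nonneg _) hM0
  obtain ⟨z, hz⟩ := cauchySeq_tendsto_of_complete
    (NonarchimedeanAddGroup.cauchySeq_of_tendsto_sub_nhds_zero (f := fun m => (u m : K)) hdiff)
  have hzr : ‖z‖ ≤ r := le_of_tendsto' hz.norm hu
  refine ⟨z, hzr, ?_⟩
  have hsum : Summable fun k => h k * z ^ k := by
    apply NonarchimedeanAddGroup.summable_of_tendsto_cofinite_zero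
    rw [Nat.cofinite_eq_atTop, tendsto_zero_iff_norm_tendsto_zero]
    refine squeeze_zero (fun k => norm_nonneg _) (fun k => ?_) hlim
    rw [norm_mul, norm_pow]
    gcongr
  have hpartial : Tendsto (fun m => ∑ k ∈ Finset.range (M + m + 1), h k * z ^ k) atTop
      (nhds 0) := by
    rw [tendsto_zero_iff_norm_tendsto_zero]
    have hbound : ∀ m, ‖∑ k ∈ Finset.range (M + m + 1), h k * z ^ k‖ ≤
        ‖z - u m‖ * (‖h M‖ * r ^ M / r) := fun m => by
      have hsub : ∑ k ∈ Finset.range (M + m + 1), h k * z ^ k =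
          ∑ k ∈ Finset.range (M + m + 1), (h k * z ^ k - h k * (u m : K) ^ k) := by
        rw [Finset.sum_sub_distrib, huroot, sub_zero]
      rw [hsub]
      refine IsUltrametricDist.norm_sum_le_of_forall_le_of_nonneg (by positivity) fun k _ => ?_
      rw [← mul_sub, norm_mul, ← mul_div_assoc, le_div_iff₀ hr]
      calc ‖h k‖ * ‖z ^ k - (u m : K) ^ k‖ * r
          = ‖h k‖ * (‖z ^ k - (u m : K) ^ k‖ * r) := by ring
        _ ≤ ‖h k‖ * (‖z - u m‖ * r ^ k) := by
          gcongr ?_ * ?_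
          exact norm_pow_sub_pow_mul_le hr.le hzr (hu m) k
        _ = ‖z - u m‖ * (‖h k‖ * r ^ k) := by ring
        _ ≤ ‖z - u m‖ * (‖h M‖ * r ^ M) := by
          gcongr ?_ * ?_
          exact hmax k
    refine squeeze_zero (fun m => norm_nonneg _) hbound ?_
    simpa using ((tendsto_const_nhds (x := z)).sub hz).norm.mul_const (‖h M‖ * r ^ M / r)
  have hlimit := hsum.hasSum.tendsto_sum_nat.comp (tendsto_add_atTop_nat (M + 1))
  have heq : ∑' k, h k * z ^ k = 0 := by
    refine tendsto_nhds_unique hlimit (hpartial.congr fun m => ?_)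
    simp only [Function.comp_apply]
    rw [show m + (M + 1) = M + m + 1 by ring]
  exact heq ▸ hsum.hasSum

end

/-- Let `K` be an algebraically closed field, complete with respect to a nontrivial
non-Archimedean absolute value. Let `b ∈ K`, `r > 0`, `n ≥ 1`, and let
`f(z) = ∑ c_k (z - b)^k` be a nonzero power series with `‖c k‖ * r ^ k → 0` and
`c 0 = ⋯ = c n = 0` (so `f` vanishes at `b` to multiplicity greater than `n`).
Here `N` is the largest index with `‖c k‖ * r ^ k` maximal (i.e. `N = K(f,r)`).
Then there is `ε > 0` such that every power series `g(z) = ∑ d_k (z - b)^k` with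
`‖d k‖ * r ^ k → 0`, `d 0 = 0`, `d j ≠ 0` for some `1 ≤ j ≤ n`, and
`‖c k - d k‖ < ε` for all `k ≤ N`, has a zero in the closed ball of radius `r`
around `b` distinct from `b`. -/
theorem perturbed_series_has_zero_ne_center
    {K : Type*} [NontriviallyNormedField K] [IsUltrametricDist K]
    [IsAlgClosed K] [CompleteSpace K]
    (b : K) (r : ℝ) (hr : 0 < r) (n : ℕ) (hn : 1 ≤ n)
    (c : ℕ → K) (hc : c ≠ 0) (hcvanish : ∀ k ≤ n, c k = 0)
    (hc0 : Tendsto (fun k => ‖c k‖ * r ^ k) atTop (nhds 0))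
    (N : ℕ)
    (hNmax : ∀ m, ‖c m‖ * r ^ m ≤ ‖c N‖ * r ^ N)
    (hNlast : ∀ m, N < m → ‖c m‖ * r ^ m < ‖c N‖ * r ^ N) :
    ∃ ε > (0 : ℝ), ∀ d : ℕ → K,
      Tendsto (fun k => ‖d k‖ * r ^ k) atTop (nhds 0) →
      d 0 = 0 → (∃ j, 1 ≤ j ∧ j ≤ n ∧ d j ≠ 0) →
      (∀ k ≤ N, ‖c k - d k‖ < ε) →
      ∃ z : K, ‖z - b‖ ≤ r ∧ z ≠ b ∧ HasSum (fun k => d k * (z - b) ^ k) 0 := by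
  have hnN : n < N := by
    by_contra! hle
    refine hc (funext fun m => ?_)
    have hm := hNmax m
    rw [hcvanish N hle, norm_zero, zero_mul] at hm
    have := nonpos_of_mul_nonpos_left hm (pow_pos hr m)
    simpa using this
  have hcN : 0 < ‖c N‖ := by
    refine pos_of_mul_pos_left ((?_ : (0 : ℝ) ≤ _).trans_lt (hNlast (N + 1) N.lt_succ_self))
      (pow_pos hr N).le
    positivity
  have ht : 0 < min 1 r := lt_min one_pos hr
  refine ⟨‖c N‖ * min 1 r ^ N, by positivity, fun d hd hd0 hdne hclose => ?_⟩
  classical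
  obtain ⟨j, ⟨hj1, hjn, hjne⟩, hjmin⟩ :
      ∃ j, (1 ≤ j ∧ j ≤ n ∧ d j ≠ 0) ∧ ∀ i < j, d i = 0 := by
    refine ⟨Nat.find hdne, Nat.find_spec hdne, fun i hi => ?_⟩
    by_contra hne
    refine Nat.find_min hdne hi ⟨?_, hi.le.trans (Nat.find_spec hdne).2.1, hne⟩
    rcases Nat.eq_zero_or_pos i with rfl | hpos
    · exact absurd hd0 hne
    · exact hpos
  have hdN : ‖d N‖ = ‖c N‖ := by
    have hlt : ‖c N - d N‖ < ‖c N‖ := (hclose N le_rfl).trans_le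
      (mul_le_of_le_one_right hcN.le (pow_le_one₀ ht.le (min_le_left 1 r)))
    have h := IsUltrametricDist.norm_eq_of_add_norm_lt_max (x := c N) (y := -d N)
      (by simpa only [← sub_eq_add_neg] using hlt.trans_le (le_max_left _ _))
    rw [h, norm_neg]
  have hjle : ‖d j‖ ≤ ‖d N‖ * r ^ (N - j) := by
    have hlt := hclose j (hjn.trans hnN.le)
    rw [hcvanish j hjn, zero_sub, norm_neg] at hlt
    rw [hdN]
    refine hlt.le.trans (mul_le_mul_of_nonneg_left ?_ hcN.le)
    exact (pow_le_pow_of_le_one ht.le (min_le_left 1 r) (Nat.sub_le N j)).trans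
      (pow_le_pow_left₀ ht.le (min_le_right 1 r) _)
  have hshift : Tendsto (fun k => ‖d (k + j)‖ * r ^ k) atTop (nhds 0) := by
    have := (hd.comp (tendsto_add_atTop_nat j)).div_const (r ^ j)
    rw [zero_div] at this
    refine this.congr fun k => ?_
    simp only [Function.comp_apply]
    rw [pow_add, ← mul_assoc, mul_div_cancel_right₀ _ (pow_pos hr j).ne']
  obtain ⟨z, hzr, hz⟩ := exists_hasSum_zero_of_norm_coeff_zero_le hr
    (h := fun k => d (k + j)) hshift (by simpa using hjne) (N := N - j) (by omega)
    (by simpa [Nat.sub_add_cancel (hjn.trans hnN.le)] using hjle)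
  have hzne : z ≠ 0 := by
    rintro rfl
    have hsingle := hasSum_single (f := fun k => d (k + j) * (0 : K) ^ k) 0
      fun k hk => by simp [hk]
    exact hjne (by simpa using hsingle.unique hz)
  refine ⟨b + z, by simpa using hzr, by simpa using hzne, ?_⟩
  rw [add_sub_cancel_left, ← hasSum_nat_add_iff' j,
    Finset.sum_eq_zero fun i hi => by rw [hjmin i (Finset.mem_range.mp hi), zero_mul], sub_zero]
  simpa [pow_add, mul_assoc] using hz.mul_right (z ^ j)
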